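/- arXiv:2509.17900 — 2 statements merged into one kernel-verified Lean document; each statement's English description precedes it below -/
import Mathlib

section
/- The truncated braid group B_3(5) = ⟨σ₁, σ₂ | σ₁σ₂σ₁ = σ₂σ₁σ₂, σ₁⁵ = σ₂⁵ = 1⟩ has order 600. -/
/-- The relations of the truncated braid group
`B₃(d) = ⟨σ₁, σ₂ | σ₁σ₂σ₁ = σ₂σ₁σ₂, σ₁^d = σ₂^d = 1⟩`. -/
def truncatedBraid3Rels (d : ℕ) : Set (FreeGroup (Fin 2)) :=
  {FreeGroup.of 0 * FreeGroup.of 1 * FreeGroup.of 0 *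
      (FreeGroup.of 1 * FreeGroup.of 0 * FreeGroup.of 1)⁻¹,
   FreeGroup.of 0 ^ d, FreeGroup.of 1 ^ d}

/-- The truncated braid group `B₃(d)`. -/
def TruncatedBraid3 (d : ℕ) : Type := PresentedGroup (truncatedBraid3Rels d)

instance (d : ℕ) : Group (TruncatedBraid3 d) := inferInstanceAs (Group (PresentedGroup _))

/-- The generator `σ₁` of `B₃(d)`. -/
def TruncatedBraid3.σ₁ (d : ℕ) : TruncatedBraid3 d := PresentedGroup.of 0

/-- The generator `σ₂` of `B₃(d)`. -/
def TruncatedBraid3.σ₂ (d : ℕ) : TruncatedBraid3 d := PresentedGroup.of 1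

/-- The full twist `Δ² = (σ₁σ₂)³` in `B₃(d)`. -/
def TruncatedBraid3.fullTwist (d : ℕ) : TruncatedBraid3 d :=
  (TruncatedBraid3.σ₁ d * TruncatedBraid3.σ₂ d) ^ 3

namespace TB5

section words

variable {G : Type*} [Group G]

/-- coset representatives of `⟨a, z⟩` -/
def W (a d : G) : Fin 12 → G :=
  ![1, d, d * a, d * (a * a), d * (a⁻¹ * a⁻¹), d * a⁻¹,
    d * (a * (a * d)), d * (a * (a * (d * a))), d * (a * (a * (d * (a * a)))),
    d * (a * (a * (d * (a⁻¹ * a⁻¹)))), d * (a * (a * (d * a⁻¹))),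
    d * (a * (a * (d * (a⁻¹ * (a⁻¹ * d)))))]

variable {a d z : G}

theorem aaa (h5 : a ^ 5 = 1) : a * (a * a) = a⁻¹ * a⁻¹ := by
  have : a * (a * a) = a ^ 5 * (a⁻¹ * a⁻¹) := by
    simp only [pow_succ, pow_zero, one_mul, mul_assoc, mul_inv_cancel_left,
      mul_inv_cancel, mul_one]
  rw [this, h5, one_mul]

theorem AAA (h5 : a ^ 5 = 1) : a⁻¹ * (a⁻¹ * a⁻¹) = a * a := by
  have : a⁻¹ * (a⁻¹ * a⁻¹) = (a ^ 5)⁻¹ * (a * a) := by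
    simp only [pow_succ, pow_zero, one_mul, mul_inv_rev, mul_assoc, inv_mul_cancel_left,
      inv_mul_cancel, mul_one]
  rw [this, h5, inv_one, one_mul]

theorem dz (hz : d * d = z) : d * z = z * d := by rw [← hz, mul_assoc]

theorem Az (hc : a * z = z * a) : a⁻¹ * z = z * a⁻¹ := by
  have : Commute a z := hc
  exact this.inv_left

theorem dad (hz : d * d = z) (hc : a * z = z * a) (hb : a * (d * a) = d * (a⁻¹ * d)) : d * (a * d) = z * (a⁻¹ * (d * a⁻¹)) := by
  have h1 : d * (a⁻¹ * d) * a⁻¹ = a * d := by rw [← hb]; group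
  have h2 : a⁻¹ * (d * (a⁻¹ * d)) = d * a := by rw [← hb]; group
  rw [← h1]
  simp only [← mul_assoc]
  rw [hz]

theorem dAAd (hz : d * d = z) (hc : a * z = z * a) (hb : a * (d * a) = d * (a⁻¹ * d)) : d * (a⁻¹ * (a⁻¹ * d)) = z⁻¹ * (a * (d * (a * (a * (d * a))))) := by
  have e : d * (a⁻¹ * (d * (d * (a⁻¹ * d)))) = z * (d * (a⁻¹ * (a⁻¹ * d))) := by
    rw [← mul_assoc d d, hz, ← mul_assoc a⁻¹ z, Az hc, mul_assoc, ← mul_assoc d z, dz hz, mul_assoc]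
  rw [eq_inv_mul_iff_mul_eq, ← e, ← hb]
  have : d * (a⁻¹ * (d * (a * (d * a)))) = (d * (a⁻¹ * d)) * (a * (d * a)) := by group
  rw [this, ← hb]; group

theorem reassoc2 {x y w : G} (h : x * y = w) (u : G) : x * (y * u) = w * u := by
  rw [← h, mul_assoc]
theorem reassoc3 {x y v w : G} (h : x * (y * v) = w) (u : G) : x * (y * (v * u)) = w * u := by
  rw [← h]; simp only [mul_assoc]
theorem reassoc4 {x y v t w : G} (h : x * (y * (v * t)) = w) (u : G) :
    x * (y * (v * (t * u))) = w * u := by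
  rw [← h]; simp only [mul_assoc]

theorem Ua (h5 : a ^ 5 = 1) (hz : d * d = z) (hc : a * z = z * a) (hb : a * (d * a) = d * (a⁻¹ * d)) : d * (a * (a * (d * (a⁻¹ * (a⁻¹ * d))))) =
    z⁻¹ * (z⁻¹ * (a * (d * (a * (a * (d * (a⁻¹ * (a⁻¹ * (d * a))))))))) := by
  have dZ : d * z⁻¹ = z⁻¹ * d := by
    have : Commute d z := dz hz
    exact this.inv_right
  have aZ : a * z⁻¹ = z⁻¹ * a := by
    have : Commute a z := hc
    exact this.inv_right
  have e := dAAd hz hc hb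
  rw [e]
  rw [reassoc2 aZ, mul_assoc, reassoc2 aZ, mul_assoc, reassoc2 dZ, mul_assoc,
    reassoc3 (aaa h5), mul_assoc, reassoc4 e]
  simp only [mul_assoc]
  rw [reassoc3 (aaa h5), mul_assoc]

theorem z10 (h5 : a ^ 5 = 1) (hz : d * d = z) (hc : a * z = z * a) (hb : a * (d * a) = d * (a⁻¹ * d)) : z ^ 10 = 1 := by
  have hu := Ua h5 hz hc hb
  set U := d * (a * (a * (d * (a⁻¹ * (a⁻¹ * d))))) with hU
  have h1 : U = z⁻¹ * (z⁻¹ * (a * (U * a))) := by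
    rw [hU]; simp only [mul_assoc]; exact hu
  have h2 : U * a * U⁻¹ = a⁻¹ * z ^ 2 := by
    have hcc : Commute a z := hc
    rw [mul_inv_eq_iff_eq_mul, (hcc.inv_left.pow_right 2).eq]
    calc U * a = z ^ 2 * a⁻¹ * (z⁻¹ * (z⁻¹ * (a * (U * a)))) := by
          rw [(hcc.inv_left.pow_right 2).eq.symm]; group
      _ = _ := by rw [← h1]
  have h3 : (U * a * U⁻¹) ^ 5 = 1 := by rw [conj_pow, h5]; group
  have hcc : Commute a⁻¹ (z ^ 2) := (show Commute a z from hc).inv_left.pow_right 2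
  rw [h2, hcc.mul_pow, inv_pow, h5, inv_one, one_mul, ← pow_mul] at h3
  exact h3

/-- normal forms -/
def S (a d z : G) (g : G) : Prop := ∃ (j i : ℤ) (k : Fin 12), g = z ^ j * (a ^ i * W a d k)

theorem S_mul (hc : a * z = z * a) (c : G) (H : ∀ k, S a d z (W a d k * c)) {g : G} (hg : S a d z g) :
    S a d z (g * c) := by
  obtain ⟨j, i, k, rfl⟩ := hg
  obtain ⟨j', i', k', h⟩ := H k
  refine ⟨j + j', i + i', k', ?_⟩
  have hcc : Commute (a ^ i) (z ^ j') := (show Commute a z from hc).zpow_zpow i j'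
  rw [mul_assoc, mul_assoc, h, zpow_add, zpow_add, ← mul_assoc (a ^ i) (z ^ j'), hcc.eq]
  simp only [mul_assoc]

theorem S_a (h5 : a ^ 5 = 1) (hz : d * d = z) (hc : a * z = z * a) (hb : a * (d * a) = d * (a⁻¹ * d)) (k : Fin 12) : S a d z (W a d k * a) := by
  have h3 := aaa h5
  have h3' := AAA h5
  fin_cases k
  · exact ⟨0, 1, 0, by simp [W]⟩
  · exact ⟨0, 0, 2, by simp [W]⟩
  · exact ⟨0, 0, 3, by simp [W, mul_assoc]⟩
  · exact ⟨0, 0, 4, by simp [W, mul_assoc, h3]⟩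
  · exact ⟨0, 0, 5, by simp [W, mul_assoc]⟩
  · exact ⟨0, 0, 1, by simp [W, mul_assoc]⟩
  · exact ⟨0, 0, 7, by simp [W, mul_assoc]⟩
  · exact ⟨0, 0, 8, by simp [W, mul_assoc]⟩
  · exact ⟨0, 0, 9, by simp [W, mul_assoc, h3]⟩
  · exact ⟨0, 0, 10, by simp [W, mul_assoc]⟩
  · exact ⟨0, 0, 6, by simp [W, mul_assoc]⟩
  · refine ⟨2, -1, 11, ?_⟩
    have hu := Ua h5 hz hc hb
    have e5 := Az hc
    have zz : z ^ (2 : ℤ) = z * z := zpow_two z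
    show d * (a * (a * (d * (a⁻¹ * (a⁻¹ * d))))) * a
      = z ^ (2 : ℤ) * (a ^ (-1 : ℤ) * (d * (a * (a * (d * (a⁻¹ * (a⁻¹ * d)))))))
    rw [zpow_neg_one, zz]
    conv_rhs => rw [hu]
    simp only [mul_assoc]
    have aZ : a⁻¹ * z⁻¹ = z⁻¹ * a⁻¹ := (show Commute a⁻¹ z from e5).inv_right
    simp only [reassoc2 aZ, mul_assoc, mul_inv_cancel_left, inv_mul_cancel_left]

theorem S_d (h5 : a ^ 5 = 1) (hz : d * d = z) (hc : a * z = z * a) (hb : a * (d * a) = d * (a⁻¹ * d)) (k : Fin 12) : S a d z (W a d k * d) := by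
  have h3 := aaa h5
  have h3' := AAA h5
  have e1 := dad hz hc hb
  have e2 := hb.symm
  have e3 := dAAd hz hc hb
  have e4 := dz hz
  have e5 := Az hc
  have dZ : d * z⁻¹ = z⁻¹ * d := (show Commute d z from e4).inv_right
  have aZ : a * z⁻¹ = z⁻¹ * a := (show Commute a z from hc).inv_right
  have e6 : d * (a * (a * (d * (a⁻¹ * d)))) = z⁻¹ * (a * (d * (a * (a * (d * (a * a)))))) := by
    rw [e2]
    simp only [reassoc3 h3, reassoc4 e3, mul_assoc]
  fin_cases k
  · exact ⟨0, 0, 1, by simp [W]⟩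
  · exact ⟨1, 0, 0, by simp [W, hz]⟩
  · exact ⟨1, -1, 5, by simp [W, mul_assoc, e1]⟩
  · exact ⟨0, 0, 6, by simp [W, mul_assoc]⟩
  · exact ⟨-1, 1, 7, by simp [W, mul_assoc, e3]⟩
  · exact ⟨0, 1, 2, by simp [W, mul_assoc, e2]⟩
  · exact ⟨1, 0, 3, by simp [W, mul_assoc, hz, hc, e4, reassoc2 hc, reassoc2 e4]⟩
  · refine ⟨2, -1, 4, ?_⟩
    have : z ^ (2 : ℤ) = z * z := zpow_two z
    simp [W, mul_assoc, e1, this, reassoc2 hc, reassoc2 e4, reassoc3 e1]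
  · refine ⟨2, -1, 10, ?_⟩
    have h : d * (a * (a * (d * (a * a)))) = a⁻¹ * (z * (d * (a * (a * (d * (a⁻¹ * d)))))) := by
      rw [e6]; group
    show d * (a * (a * (d * (a * a)))) * d
      = z ^ (2 : ℤ) * (a ^ (-1 : ℤ) * (d * (a * (a * (d * a⁻¹)))))
    have : z ^ (2 : ℤ) = z * z := zpow_two z
    rw [h, zpow_neg_one, this]
    simp only [mul_assoc, hz, hc, e4, e5, reassoc2 hc, reassoc2 e4, reassoc2 e5]
  · exact ⟨0, 0, 11, by simp [W, mul_assoc]⟩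
  · exact ⟨-1, 1, 8, by simp [W, mul_assoc, e6]⟩
  · exact ⟨1, 0, 9, by
      simp [W, mul_assoc, hz, hc, e4, e5, reassoc2 hc, reassoc2 e4, reassoc2 e5]⟩

theorem upper (h5 : a ^ 5 = 1) (hz : d * d = z) (hc : a * z = z * a) (hb : a * (d * a) = d * (a⁻¹ * d)) (hgen : Subgroup.closure {a, d} = ⊤) : Finite G ∧ Nat.card G ≤ 600 := by
  have hz10 := z10 h5 hz hc hb
  have hS : ∀ g, S a d z g := by
    have hA : ∀ g, S a d z g → S a d z (g * a) := fun g => S_mul hc a (S_a h5 hz hc hb)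
    have hD : ∀ g, S a d z g → S a d z (g * d) := fun g => S_mul hc d (S_d h5 hz hc hb)
    have hpow : ∀ c : G, (∀ g, S a d z g → S a d z (g * c)) → ∀ n : ℕ, ∀ g, S a d z g →
        S a d z (g * c ^ n) := by
      intro c h n
      induction n with
      | zero => intro g hg; simpa using hg
      | succ n ih => intro g hg; rw [pow_succ, ← mul_assoc]; exact h _ (ih g hg)
    have ainv : a⁻¹ = a ^ 4 := by
      rw [inv_eq_iff_mul_eq_one, ← pow_succ', h5]
    have dinv : d⁻¹ = d ^ 19 := by
      rw [inv_eq_iff_mul_eq_one, ← pow_succ', show 19 + 1 = 2 * 10 by norm_num, pow_mul, pow_two,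
        hz, hz10]
    intro g
    have hg : g ∈ Subgroup.closure {a, d} := by rw [hgen]; trivial
    induction hg using Subgroup.closure_induction_right with
    | one => exact ⟨0, 0, 0, by simp [W]⟩
    | mul_right x hx y hy ih =>
      rcases hy with rfl | rfl
      · exact hA _ ih
      · exact hD _ ih
    | mul_inv_cancel x hx y hy ih =>
      rcases hy with rfl | rfl
      · rw [ainv]; exact hpow _ hA _ _ ih
      · rw [dinv]; exact hpow _ hD _ _ ih
  let F : Fin 10 × Fin 5 × Fin 12 → G := fun p =>
    z ^ (p.1 : ℕ) * (a ^ (p.2.1 : ℕ) * W a d p.2.2)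
  have red : ∀ (x : G) (n : ℕ) [NeZero n], x ^ n = 1 → ∀ j : ℤ, ∃ k : Fin n, x ^ j = x ^ (k : ℕ) := by
    intro x n hn hx j
    have hn0 : (n : ℤ) ≠ 0 := by exact_mod_cast hn.out
    have h1 := Int.emod_nonneg j hn0
    have h2 := Int.emod_lt_of_pos j (b := n) (by have := hn.out; omega)
    refine ⟨⟨(j % n).toNat, by omega⟩, ?_⟩
    rw [← zpow_natCast, Int.toNat_of_nonneg h1]
    conv_lhs => rw [← Int.mul_ediv_add_emod j n, zpow_add, zpow_mul, zpow_natCast, hx]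
    simp
  have hF : Function.Surjective F := by
    intro g
    obtain ⟨j, i, k, rfl⟩ := hS g
    obtain ⟨j', hj⟩ := red z 10 hz10 j
    obtain ⟨i', hi⟩ := red a 5 h5 i
    exact ⟨(j', i', k), by simp only [F]; rw [hj, hi]⟩
  refine ⟨Finite.of_surjective F hF, ?_⟩
  have := Nat.card_le_card_of_surjective F hF
  simpa using this

end words

/-- quadruples of determinant one -/
abbrev Q : Type := {v : ZMod 5 × ZMod 5 × ZMod 5 × ZMod 5 // v.1 * v.2.2.2 - v.2.1 * v.2.2.1 = 1}

theorem card_Q : Fintype.card Q = 120 := by decide +kernel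

abbrev SL := Matrix.SpecialLinearGroup (Fin 2) (ZMod 5)

def A : SL := ⟨!![1, 1; 0, 1], by simp [Matrix.det_fin_two]⟩
def B : SL := ⟨!![1, 0; -1, 1], by simp [Matrix.det_fin_two]⟩

abbrev C := Multiplicative (ZMod 5)
def c : C := Multiplicative.ofAdd 1

def toSL (q : Q) : SL := ⟨!![q.1.1, q.1.2.1; q.1.2.2.1, q.1.2.2.2], by
  rw [Matrix.det_fin_two]; exact q.2⟩

theorem toSL_inj : Function.Injective toSL := by
  rintro ⟨⟨p, q, r, s⟩, h⟩ ⟨⟨p', q', r', s'⟩, h'⟩ he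
  have he' := congrArg Subtype.val he
  simp only [toSL] at he'
  have h00 := congrFun (congrFun he' 0) 0
  have h01 := congrFun (congrFun he' 0) 1
  have h10 := congrFun (congrFun he' 1) 0
  have h11 := congrFun (congrFun he' 1) 1
  simp at h00 h01 h10 h11
  simp [h00, h01, h10, h11]

theorem A_pow (n : ℕ) : ((A ^ n : SL) : Matrix (Fin 2) (Fin 2) (ZMod 5)) = !![1, (n : ZMod 5); 0, 1] := by
  induction n with
  | zero => ext i j; fin_cases i <;> fin_cases j <;> simp
  | succ n ih =>
    rw [pow_succ, Matrix.SpecialLinearGroup.coe_mul, ih]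
    ext i j; fin_cases i <;> fin_cases j <;> simp [A, add_comm]

theorem B_pow (n : ℕ) : ((B ^ n : SL) : Matrix (Fin 2) (Fin 2) (ZMod 5)) = !![1, 0; -(n : ZMod 5), 1] := by
  induction n with
  | zero => ext i j; fin_cases i <;> fin_cases j <;> simp
  | succ n ih =>
    rw [pow_succ, Matrix.SpecialLinearGroup.coe_mul, ih]
    ext i j; fin_cases i <;> fin_cases j <;> simp [B]; try ring

instance : Fact (Nat.Prime 5) := ⟨by norm_num⟩

theorem mem_aux (K : Subgroup SL) (hA : A ∈ K) (hB : B ∈ K) (M : SL) (h : M.1 1 0 ≠ 0) : M ∈ K := by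
  have hdet := M.2
  rw [Matrix.det_fin_two] at hdet
  have key : M = A ^ ((M.1 0 0 - 1) / M.1 1 0).val * B ^ (-M.1 1 0).val *
      A ^ ((M.1 1 1 - 1) / M.1 1 0).val := by
    apply Subtype.ext
    rw [Matrix.SpecialLinearGroup.coe_mul, Matrix.SpecialLinearGroup.coe_mul, A_pow, A_pow, B_pow]
    simp only [ZMod.natCast_val, ZMod.cast_id', id_eq, neg_neg]
    ext i j
    fin_cases i <;> fin_cases j <;> simp [Matrix.mul_apply, Fin.sum_univ_two] <;> field_simp <;>
      first | ring1 | linear_combination -hdet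
  rw [key]
  exact K.mul_mem (K.mul_mem (K.pow_mem hA _) (K.pow_mem hB _)) (K.pow_mem hA _)

theorem mem_all (K : Subgroup SL) (hA : A ∈ K) (hB : B ∈ K) (M : SL) : M ∈ K := by
  by_cases h : M.1 1 0 = 0
  · have hdet := M.2
    rw [Matrix.det_fin_two, h, mul_zero, sub_zero] at hdet
    have h1 : (M * B).1 1 0 ≠ 0 := by
      rw [Matrix.SpecialLinearGroup.coe_mul]
      simp only [Matrix.mul_apply, Fin.sum_univ_two, h, B]
      simp only [Matrix.of_apply, Matrix.cons_val', Matrix.cons_val_zero, Matrix.cons_val_one,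
        Matrix.cons_val_fin_one, zero_mul, zero_add, mul_neg, mul_one, ne_eq, neg_eq_zero]
      intro h0
      rw [h0, mul_zero] at hdet
      exact zero_ne_one hdet
    have := K.mul_mem (mem_aux K hA hB _ h1) (K.inv_mem hB)
    simpa using this
  · exact mem_aux K hA hB M h

theorem range_top (R : Subgroup (SL × C)) (hA : (A, c) ∈ R) (hB : (B, c) ∈ R) : R = ⊤ := by
  have hc : ((1 : SL), c) ∈ R := by
    have h := R.pow_mem (R.mul_mem hA hB) 18
    have e : ((A, c) * (B, c)) ^ 18 = ((1 : SL), c) := by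
      have h3 : (A * B) ^ 3 = -1 := by decide
      refine Prod.ext ?_ (by decide)
      show (A * B) ^ 18 = 1
      rw [show 18 = 3 * 6 by norm_num, pow_mul, h3]
      decide
    rwa [e] at h
  have hK : ∀ M : SL, (M, (1 : C)) ∈ R := by
    intro M
    have := mem_all (R.comap (MonoidHom.inl SL C))
      (by simpa using R.mul_mem hA (R.inv_mem hc)) (by simpa using R.mul_mem hB (R.inv_mem hc)) M
    simpa using this
  rw [eq_top_iff]
  rintro ⟨M, t⟩ -
  have ht : t = c ^ (Multiplicative.toAdd t).val := by
    revert t; decide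
  have := R.mul_mem (hK M) (R.pow_mem hc (Multiplicative.toAdd t).val)
  rw [Prod.pow_mk, one_pow, ← ht] at this
  simpa using this

theorem card_target : 600 ≤ Nat.card (SL × C) := by
  have h : Function.Injective (Prod.map toSL (id : C → C)) := toSL_inj.prodMap Function.injective_id
  have := Nat.card_le_card_of_injective _ h
  have e : Nat.card (Q × C) = 600 := by
    rw [Nat.card_prod, Nat.card_eq_fintype_card, card_Q]
    have : Nat.card C = 5 := by
      rw [Nat.card_congr Multiplicative.toAdd, Nat.card_zmod]
    rw [this]
  rwa [e] at this

theorem rel_braid : TruncatedBraid3.σ₁ 5 * TruncatedBraid3.σ₂ 5 * TruncatedBraid3.σ₁ 5 =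
    TruncatedBraid3.σ₂ 5 * TruncatedBraid3.σ₁ 5 * TruncatedBraid3.σ₂ 5 := by
  have h := PresentedGroup.one_of_mem (rels := truncatedBraid3Rels 5)
    (x := FreeGroup.of 0 * FreeGroup.of 1 * FreeGroup.of 0 *
      (FreeGroup.of 1 * FreeGroup.of 0 * FreeGroup.of 1)⁻¹) (by simp [truncatedBraid3Rels])
  rw [map_mul, map_inv, mul_inv_eq_one] at h
  exact h

theorem rel_pow : TruncatedBraid3.σ₁ 5 ^ 5 = 1 :=
  PresentedGroup.one_of_mem (rels := truncatedBraid3Rels 5)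
    (x := FreeGroup.of 0 ^ 5) (by simp [truncatedBraid3Rels])

theorem gen_top : Subgroup.closure {TruncatedBraid3.σ₁ 5, TruncatedBraid3.σ₂ 5} = ⊤ := by
  have h := PresentedGroup.closure_range_of (truncatedBraid3Rels 5)
  have e : Set.range (PresentedGroup.of : Fin 2 → PresentedGroup (truncatedBraid3Rels 5)) =
      {PresentedGroup.of 0, PresentedGroup.of 1} := by
    ext x; simp [Fin.exists_fin_two, eq_comm]
  rw [e] at h
  exact h

theorem upper_bound : Finite (TruncatedBraid3 5) ∧ Nat.card (TruncatedBraid3 5) ≤ 600 := by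
  have hb := rel_braid
  have h5 := rel_pow
  have hg := gen_top
  generalize TruncatedBraid3.σ₁ 5 = a at *
  generalize TruncatedBraid3.σ₂ 5 = b at *
  have h1 : (a * b * a) * a = b * (a * b * a) := by
    conv_lhs => rw [hb]
    simp only [mul_assoc]
  have h2 : (a * b * a) * b = a * (a * b * a) := by
    conv_rhs => rw [hb]
    simp only [mul_assoc]
  refine upper (a := a) (d := a * b * a) (z := (a * b * a) * (a * b * a)) h5 rfl ?_ ?_ ?_
  · rw [mul_assoc (a * b * a) (a * b * a) a, h1, ← mul_assoc, ← h2, mul_assoc]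
  · have : a * b * a * (a⁻¹ * (a * b * a)) = a * (b * a * b) * a := by group
    rw [this, ← hb]
    simp only [mul_assoc]
  · rw [eq_top_iff, ← hg, Subgroup.closure_le]
    have ha : a ∈ Subgroup.closure {a, a * b * a} := Subgroup.subset_closure (by simp)
    have hd : a * b * a ∈ Subgroup.closure {a, a * b * a} := Subgroup.subset_closure (by simp)
    rintro x (rfl | rfl)
    · exact ha
    · have := Subgroup.mul_mem _ (Subgroup.mul_mem _ (Subgroup.inv_mem _ ha) hd)
        (Subgroup.inv_mem _ ha)
      have e : a⁻¹ * (a * x * a) * a⁻¹ = x := by group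
      rwa [e] at this

theorem hom_rels : ∀ r ∈ truncatedBraid3Rels 5,
    FreeGroup.lift (![(A, c), (B, c)] : Fin 2 → SL × C) r = 1 := by
  rintro r (rfl | rfl | rfl)
  · simp only [map_mul, map_inv, FreeGroup.lift_apply_of, mul_inv_eq_one]
    decide
  · simp only [map_pow, FreeGroup.lift_apply_of]
    decide
  · simp only [map_pow, FreeGroup.lift_apply_of]
    decide

def hom : TruncatedBraid3 5 →* SL × C := PresentedGroup.toGroup hom_rels

theorem hom_surj : Function.Surjective hom := by
  rw [← MonoidHom.range_eq_top]
  apply range_top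
  · exact ⟨TruncatedBraid3.σ₁ 5, PresentedGroup.toGroup.of hom_rels⟩
  · exact ⟨TruncatedBraid3.σ₂ 5, PresentedGroup.toGroup.of hom_rels⟩

end TB5

/-- The truncated braid group `B₃(5)` has order 600. -/
theorem truncatedBraid3_card_5 : Nat.card (TruncatedBraid3 5) = 600 := by
  obtain ⟨hfin, hle⟩ := TB5.upper_bound
  exact le_antisymm hle (TB5.card_target.trans
    (Nat.card_le_card_of_surjective TB5.hom TB5.hom_surj))
end

section
/- For d ≥ 6, the truncated braid group B_3(d) is infinite; equivalently, for d ≥ 6 the element Δ² = (σ₁σ₂)³ has infinite order in B_3(d). -/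
/-- A group criterion: it suffices to find `c`, `u` in some group. -/
theorem tb3_of_group {G : Type*} [Group G] (d : ℕ) (c u : G) (hc : c ^ d = 1)
    (hcu : c * u * c = u * c⁻¹ * u) (hu : ¬ IsOfFinOrder (u * u)) :
    Infinite (TruncatedBraid3 d) ∧ ¬ IsOfFinOrder (TruncatedBraid3.fullTwist d) := by
  have hbr : c * (c⁻¹ * u * c⁻¹) * c = (c⁻¹ * u * c⁻¹) * c * (c⁻¹ * u * c⁻¹) := by
    have h1 : (c⁻¹ * u * c⁻¹) * c * (c⁻¹ * u * c⁻¹) = c⁻¹ * (u * c⁻¹ * u) * c⁻¹ := by group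
    rw [h1, ← hcu]; group
  have hs2 : (c⁻¹ * u * c⁻¹) ^ d = 1 := by
    have h1 : c⁻¹ * u * c⁻¹ = u * c * u⁻¹ := by
      have h2 : u = c⁻¹ * u * c⁻¹ * u * c⁻¹ := by
        have : c⁻¹ * (u * c⁻¹ * u) * c⁻¹ = u := by rw [← hcu]; group
        simpa [mul_assoc] using this.symm
      have h3 : u * c = c⁻¹ * u * c⁻¹ * u := by
        calc u * c = (c⁻¹ * u * c⁻¹ * u * c⁻¹) * c := by rw [← h2]
          _ = _ := by group
      rw [h3]; group
    rw [h1, conj_pow, hc]; group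
  let f : Fin 2 → G := ![c, c⁻¹ * u * c⁻¹]
  have hrel : ∀ r ∈ truncatedBraid3Rels d, FreeGroup.lift f r = 1 := by
    intro r hr
    rcases hr with rfl | rfl | rfl
    · simp only [map_mul, map_inv, FreeGroup.lift_apply_of]
      exact mul_inv_eq_one.mpr hbr
    · simpa [f] using hc
    · simpa [f] using hs2
  let F : TruncatedBraid3 d →* G := PresentedGroup.toGroup hrel
  have hF : F (TruncatedBraid3.fullTwist d) = u * u := by
    have e1 : F (TruncatedBraid3.σ₁ d) = c := PresentedGroup.toGroup.of hrel
    have e2 : F (TruncatedBraid3.σ₂ d) = c⁻¹ * u * c⁻¹ := PresentedGroup.toGroup.of hrel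
    rw [TruncatedBraid3.fullTwist, map_pow, map_mul, e1, e2]
    have h1 : (c * (c⁻¹ * u * c⁻¹)) ^ 3 = u * (c⁻¹ * (u * c⁻¹ * u) * c⁻¹) := by
      rw [pow_three]; group
    rw [h1, ← hcu]; group
  have key : ¬ IsOfFinOrder (TruncatedBraid3.fullTwist d) := by
    intro h
    apply hu
    rw [← hF]
    exact F.isOfFinOrder h
  refine ⟨?_, key⟩
  by_contra hfin
  rw [not_infinite_iff_finite] at hfin
  exact key (isOfFinOrder_of_finite _)

/-- A dynamical criterion: a set with a rotation `C`, an involution `U` and a cocycle `φ`. -/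
theorem tb3_of_cocycle {D : Type*} [Nonempty D] (d : ℕ) (C : Equiv.Perm D) (U : D → D)
    (φ : D → ℝ) (τ : ℝ) (hτ : τ ≠ 0) (hC : ∀ z, (C ^ d) z = z) (hU : ∀ z, U (U z) = z)
    (hCU : ∀ z, C (U (C z)) = U (C⁻¹ (U z)))
    (h1 : ∀ z, φ (C z) = φ z + φ (C⁻¹ (U z)))
    (h2 : ∀ z, φ z + φ (U z) = τ) :
    Infinite (TruncatedBraid3 d) ∧ ¬ IsOfFinOrder (TruncatedBraid3.fullTwist d) := by
  let c : Equiv.Perm (D × ℝ) :=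
    { toFun := fun p => (C p.1, p.2)
      invFun := fun p => (C⁻¹ p.1, p.2)
      left_inv := fun p => by simp
      right_inv := fun p => by simp }
  let u : Equiv.Perm (D × ℝ) :=
    { toFun := fun p => (U p.1, p.2 + φ p.1)
      invFun := fun p => (U p.1, p.2 - φ (U p.1))
      left_inv := fun p => by simp [hU]
      right_inv := fun p => by simp [hU] }
  have hc : ∀ p, c p = (C p.1, p.2) := fun _ => rfl
  have hci : ∀ p, c⁻¹ p = (C⁻¹ p.1, p.2) := fun _ => rfl
  have hu : ∀ p, u p = (U p.1, p.2 + φ p.1) := fun _ => rfl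
  have hcn : ∀ (n : ℕ) p, (c ^ n) p = ((C ^ n) p.1, p.2) := by
    intro n
    induction n with
    | zero => intro p; simp
    | succ n ih => intro p; rw [pow_succ, Equiv.Perm.mul_apply, ih, hc, pow_succ]; rfl
  have hun : ∀ (n : ℕ) p, ((u * u) ^ n) p = (p.1, p.2 + n * τ) := by
    intro n
    induction n with
    | zero => intro p; simp
    | succ n ih =>
      intro p
      rw [pow_succ, Equiv.Perm.mul_apply, ih, Equiv.Perm.mul_apply, hu, hu]
      simp only [hU, Prod.mk.injEq, true_and]
      rw [← h2 p.1]; push_cast; ring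
  refine tb3_of_group d c u ?_ ?_ ?_
  · ext1 p
    rw [hcn, hC]; rfl
  · ext1 p
    simp only [Equiv.Perm.mul_apply, hc, hci, hu, hCU, h1, Prod.mk.injEq, true_and]
    ring
  · intro h
    obtain ⟨n, hn, h⟩ := isOfFinOrder_iff_pow_eq_one.mp h
    obtain ⟨z⟩ := ‹Nonempty D›
    have := hun n (z, 0)
    rw [h] at this
    simp only [Equiv.Perm.one_apply, Prod.mk.injEq, true_and, zero_add] at this
    have hn' : (n : ℝ) ≠ 0 := by positivity
    exact mul_ne_zero hn' hτ this.symm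

/-- Multiplication by a unit complex number on a ball of the plane. -/
noncomputable def tb3Rot (P : ℂ → Prop) (ζ : ℂ) (h0 : ζ ≠ 0) (h1 : ∀ z, P z → P (ζ * z))
    (h2 : ∀ z, P z → P (ζ⁻¹ * z)) : Equiv.Perm {z : ℂ // P z} where
  toFun z := ⟨ζ * z.1, h1 _ z.2⟩
  invFun z := ⟨ζ⁻¹ * z.1, h2 _ z.2⟩
  left_inv z := by ext; simp [h0]
  right_inv z := by ext; simp [h0]

theorem tb3Rot_pow (P : ℂ → Prop) (ζ : ℂ) (h0 h1 h2) (n : ℕ) (z : {z : ℂ // P z}) :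
    ((tb3Rot P ζ h0 h1 h2 ^ n) z).1 = ζ ^ n * z.1 := by
  induction n generalizing z with
  | zero => simp
  | succ n ih =>
    rw [pow_succ, Equiv.Perm.mul_apply, ih]
    change ζ ^ n * (ζ * z.1) = _
    ring

/-- A form of the criterion with a concrete domain in the plane. -/
theorem tb3_of_plane (P : ℂ → Prop) (hP : P 0) (d : ℕ) (ζ : ℂ) (h0 : ζ ≠ 0)
    (hζ : ζ ^ d = 1) (hP1 : ∀ z, P z → P (ζ * z)) (hP2 : ∀ z, P z → P (ζ⁻¹ * z))
    (U : ℂ → ℂ) (hPU : ∀ z, P z → P (U z)) (φ : ℂ → ℝ) (τ : ℝ) (hτ : τ ≠ 0)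
    (hU : ∀ z, P z → U (U z) = z)
    (hCU : ∀ z, P z → ζ * U (ζ * z) = U (ζ⁻¹ * U z))
    (h1 : ∀ z, P z → φ (ζ * z) = φ z + φ (ζ⁻¹ * U z))
    (h2 : ∀ z, P z → φ z + φ (U z) = τ) :
    Infinite (TruncatedBraid3 d) ∧ ¬ IsOfFinOrder (TruncatedBraid3.fullTwist d) := by
  have : Nonempty {z : ℂ // P z} := ⟨⟨0, hP⟩⟩
  refine tb3_of_cocycle (D := {z : ℂ // P z}) d (tb3Rot P ζ h0 hP1 hP2)
    (fun z => ⟨U z.1, hPU _ z.2⟩) (fun z => φ z.1) τ hτ ?_ ?_ ?_ ?_ ?_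
  · intro z; ext1; rw [tb3Rot_pow, hζ, one_mul]
  · intro z; ext1; exact hU _ z.2
  · intro z; ext1; exact hCU _ z.2
  · intro z; exact h1 _ z.2
  · intro z; exact h2 _ z.2

theorem tb3_arg_add {x y : ℂ} (hx : 0 < x.re) (hy : 0 < y.re) :
    (x * y).arg = x.arg + y.arg := by
  have h1 := Complex.abs_arg_lt_pi_div_two_iff.mpr (Or.inl hx)
  have h2 := Complex.abs_arg_lt_pi_div_two_iff.mpr (Or.inl hy)
  rw [abs_lt] at h1 h2
  refine Complex.arg_mul ?_ ?_ ⟨by linarith, by linarith⟩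
  · rintro rfl; simp at hx
  · rintro rfl; simp at hy

/-- The hyperbolic case. -/
theorem tb3_hyp (d : ℕ) (ζ : ℂ) (r : ℝ) (hζ : ζ ^ d = 1) (hn : ‖ζ‖ = 1)
    (hr0 : 0 < r) (hr1 : r < 1) (him : 0 < ζ.im) (hr : (r : ℂ) ^ 2 = ζ + ζ⁻¹ - 1) :
    Infinite (TruncatedBraid3 d) ∧ ¬ IsOfFinOrder (TruncatedBraid3.fullTwist d) := by
  have h0 : ζ ≠ 0 := by rintro rfl; simp at hn
  have hinv : ‖ζ⁻¹‖ = 1 := by simp [hn]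
  have hre : ∀ z : ℂ, ‖z‖ < 1 → 0 < (1 - r * z).re := by
    intro z hz
    have := (abs_lt.mp ((Complex.abs_re_le_norm z).trans_lt hz)).2
    simp
    nlinarith
  have hne : ∀ z : ℂ, ‖z‖ < 1 → (1 - r * z) ≠ 0 := by
    intro z hz h
    have := hre z hz
    rw [h] at this; simp at this
  set U : ℂ → ℂ := fun z => (r - z) / (1 - r * z) with hUdef
  have hP1 : ∀ z : ℂ, ‖z‖ < 1 → ‖ζ * z‖ < 1 := fun z hz => by rw [norm_mul, hn, one_mul]; exact hz
  have hP2 : ∀ z : ℂ, ‖z‖ < 1 → ‖ζ⁻¹ * z‖ < 1 := fun z hz => by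
    rw [norm_mul, hinv, one_mul]; exact hz
  have hPU : ∀ z : ℂ, ‖z‖ < 1 → ‖U z‖ < 1 := by
    intro z hz
    rw [hUdef]
    simp only [norm_div]
    rw [div_lt_one (norm_pos_iff.mpr (hne z hz))]
    rw [← sq_lt_sq₀ (norm_nonneg _) (norm_nonneg _), Complex.sq_norm, Complex.sq_norm]
    have hz2 : Complex.normSq z < 1 := by
      rw [← Complex.sq_norm]; nlinarith [norm_nonneg z]
    rw [Complex.normSq_apply] at *
    rw [Complex.normSq_apply]
    simp
    nlinarith [mul_pos (sub_pos.mpr hz2) (show 0 < 1 - r * r by nlinarith)]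
  have hUm : ∀ z : ℂ, ‖z‖ < 1 → (1 - r * z) * U z = r - z := by
    intro z hz
    have := hne z hz
    rw [hUdef]; field_simp
  set l : ℂ := 1 - r ^ 2 * ζ⁻¹ with hl
  have hrn : ‖(r : ℂ) * ζ⁻¹‖ < 1 := by
    rw [norm_mul, hinv, mul_one, Complex.norm_real, Real.norm_eq_abs, abs_of_pos hr0]; exact hr1
  have hlre : 0 < l.re := by
    have := hre _ hrn
    rw [hl]; convert this using 2; ring
  have hlim : 0 < l.im := by
    have h3 : (ζ⁻¹).im = - ζ.im := by
      rw [Complex.inv_im, Complex.normSq_eq_norm_sq, hn]; simp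
    have : l.im = r ^ 2 * ζ.im := by
      rw [hl, ← Complex.ofReal_pow, Complex.sub_im, Complex.im_ofReal_mul, h3]; simp
    rw [this]; positivity
  have hlζ : l * ζ = 1 - ζ⁻¹ := by
    rw [hl, hr]; field_simp; ring
  have hr3 : (1 : ℂ) - r ^ 2 ≠ 0 := by
    have : (1 : ℝ) - r ^ 2 ≠ 0 := by nlinarith
    exact_mod_cast this
  have hUU : ∀ z : ℂ, ‖z‖ < 1 → (1 - r * z) * (1 - r * U z) = 1 - r ^ 2 := by
    intro z hz
    linear_combination (-r : ℂ) * hUm z hz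
  have hfac : ∀ z : ℂ, ‖z‖ < 1 →
      (1 - r * z) * (1 - r * (ζ⁻¹ * U z)) = l * (1 - r * (ζ * z)) := by
    intro z hz
    have : l * (1 - r * (ζ * z)) = l - r * z * (l * ζ) := by ring
    rw [this, hlζ, hl]
    linear_combination (-r * ζ⁻¹ : ℂ) * hUm z hz
  refine tb3_of_plane (fun z => ‖z‖ < 1) (by simp) d ζ h0 hζ hP1 hP2 U hPU
    (fun z => (1 - r * z).arg - l.arg) (-2 * l.arg) ?_ ?_ ?_ ?_ ?_
  · have : l.arg ≠ 0 := by
      intro h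
      rw [Complex.arg_eq_zero_iff] at h
      exact hlim.ne' h.2
    simpa using this
  · intro z hz
    apply mul_left_cancel₀ (mul_ne_zero (hne z hz) (hne _ (hPU z hz)))
    rw [mul_assoc, hUm _ (hPU z hz), hUU z hz]
    linear_combination -hUm z hz
  · intro z hz
    have hw := hP2 _ (hPU z hz)
    have hv := hP1 z hz
    have hlne : l ≠ 0 := by intro h; rw [h] at hlre; simp at hlre
    have e1 := hUm _ hw
    have e2 := hUm _ hv
    have e3 := hfac z hz
    have e4 := hUm z hz
    apply mul_left_cancel₀ (mul_ne_zero (hne z hz) (hne _ hw))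
    rw [mul_assoc _ _ (U (ζ⁻¹ * U z)), e1, e3]
    have e5 : l * (1 - r * (ζ * z)) * (ζ * U (ζ * z)) = l * ζ * (r - ζ * z) := by
      linear_combination l * ζ * e2
    rw [e5, hlζ]
    have e6 : (1 - r * z) * (r - ζ⁻¹ * U z) = (1 - r * z) * r - ζ⁻¹ * (r - z) := by
      linear_combination -ζ⁻¹ * e4
    rw [e6]
    have e7 : ζ⁻¹ * ζ = 1 := inv_mul_cancel₀ h0
    linear_combination z * hr + z * e7
  · intro z hz
    have := congrArg Complex.arg (hfac z hz)
    rw [tb3_arg_add (hre z hz) (hre _ (hP2 _ (hPU z hz))),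
      tb3_arg_add hlre (hre _ (hP1 z hz))] at this
    linarith
  · intro z hz
    have := congrArg Complex.arg (hUU z hz)
    rw [tb3_arg_add (hre z hz) (hre _ (hPU z hz))] at this
    have h4 : ((1 : ℂ) - r ^ 2).arg = 0 := by
      have : (1 : ℂ) - r ^ 2 = ((1 - r ^ 2 : ℝ) : ℂ) := by push_cast; ring
      rw [this]
      exact Complex.arg_ofReal_of_nonneg (by nlinarith)
    linarith

/-- The Euclidean case `d = 6`. -/
theorem tb3_euc (d : ℕ) (ζ : ℂ) (hζ : ζ ^ d = 1) (h0 : ζ ≠ 0) (him : 0 < ζ.im)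
    (hr : ζ + ζ⁻¹ = 1) :
    Infinite (TruncatedBraid3 d) ∧ ¬ IsOfFinOrder (TruncatedBraid3.fullTwist d) := by
  have hi : ζ⁻¹ = 1 - ζ := by linear_combination hr
  have hq : ζ * (1 - ζ) = 1 := by rw [← hi]; exact mul_inv_cancel₀ h0
  refine tb3_of_plane (fun _ => True) trivial d ζ h0 hζ (fun _ _ => trivial) (fun _ _ => trivial)
    (fun z => 1 - z) (fun _ _ => trivial) (fun z => -z.im - ζ.im) (-2 * ζ.im) ?_ ?_ ?_ ?_ ?_
  · nlinarith
  · intro z _; ring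
  · intro z _
    simp only [hi]
    linear_combination z * hq
  · intro z _
    simp only [hi]
    simp
    ring
  · intro z _
    simp
    ring

/-- For `d ≥ 6`, the truncated braid group `B₃(d)` is infinite; equivalently, the
full twist `Δ² = (σ₁σ₂)³` has infinite order in `B₃(d)`. -/
theorem truncatedBraid3_infinite_of_six_le (d : ℕ) (hd : 6 ≤ d) :
    Infinite (TruncatedBraid3 d) ∧ ¬ IsOfFinOrder (TruncatedBraid3.fullTwist d) := by
  have hpi := Real.pi_pos
  have hd' : (6 : ℝ) ≤ d := by exact_mod_cast hd
  have hd0 : (0 : ℝ) < d := by linarith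
  set θ : ℝ := 2 * Real.pi / d with hθ
  have hθ0 : 0 < θ := by positivity
  have hθ1 : θ ≤ Real.pi / 3 := by
    rw [hθ, div_le_div_iff₀ hd0 (by norm_num)]; nlinarith
  set ζ : ℂ := Complex.exp (θ * Complex.I) with hζdef
  have hζ : ζ ^ d = 1 := by
    rw [hζdef, ← Complex.exp_nat_mul, ← Complex.exp_two_pi_mul_I]
    congr 1
    have : (d : ℂ) ≠ 0 := by exact_mod_cast hd0.ne'
    rw [hθ]; push_cast; field_simp
  have hn : ‖ζ‖ = 1 := Complex.norm_exp_ofReal_mul_I θ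
  have h0 : ζ ≠ 0 := Complex.exp_ne_zero _
  have him : 0 < ζ.im := by
    rw [hζdef, Complex.exp_ofReal_mul_I_im]
    exact Real.sin_pos_of_pos_of_lt_pi hθ0 (by linarith)
  have hsum : ζ + ζ⁻¹ = ((2 * Real.cos θ : ℝ) : ℂ) := by
    rw [hζdef, ← Complex.exp_neg]
    push_cast
    rw [Complex.two_cos]
    congr 2; ring
  rcases hd.eq_or_lt with h6 | h7
  · refine tb3_euc d ζ hζ h0 him ?_
    have : θ = Real.pi / 3 := by rw [hθ, ← h6]; push_cast; ring
    rw [hsum, this, Real.cos_pi_div_three]; norm_num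
  · have h7' : (6 : ℝ) < d := by exact_mod_cast h7
    have hθ2 : θ < Real.pi / 3 := by
      rw [hθ, div_lt_div_iff₀ hd0 (by norm_num)]; nlinarith
    have hc1 : 1 / 2 < Real.cos θ := by
      rw [← Real.cos_pi_div_three]
      exact Real.cos_lt_cos_of_nonneg_of_le_pi hθ0.le (by linarith) hθ2
    have hc2 : Real.cos θ < 1 := by
      rw [← Real.cos_zero]
      exact Real.cos_lt_cos_of_nonneg_of_le_pi le_rfl (by linarith) hθ0
    refine tb3_hyp d ζ (Real.sqrt (2 * Real.cos θ - 1)) hζ hn (Real.sqrt_pos.mpr (by linarith))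
      ?_ him ?_
    · rw [Real.sqrt_lt' one_pos]; linarith
    · rw [hsum, ← Complex.ofReal_pow, Real.sq_sqrt (by linarith)]; push_cast; ring
end
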